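/- arXiv:1211.4605 — 2 statements merged into one kernel-verified Lean document; each statement's English description precedes it below -/
import Mathlib

section
/- Let q ∈ (0,1) and φ ∈ ℝ. On ℓ²(ℤ₊²), let Z₁₁, Z₂₁, Z₂₂ be the unique bounded operators with Z₁₁e_{k,l} = q^{2k}e^{iφ}e_{k,l} − q⁻¹√((1−q^{4l})(1−q^{2k+2})(1−q^{2k+4})) e_{k+2,l−1} (the second term being 0 when l = 0), Z₂₁e_{k,l} = q^{2l}√(1−q^{2k+2}) e_{k+1,l}, and Z₂₂e_{k,l} = √(1−q^{4l+4}) e_{k,l+1}. Then this triple is irreducible: every bounded operator on ℓ²(ℤ₊²) commuting with Z₁₁, Z₂₁, Z₂₂ and their adjoints is a scalar multiple of the identity. -/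
open ContinuousLinearMap Complex

noncomputable section

/-- `ℓ²`-space over an index type, with complex coefficients. -/
abbrev L2 (ι : Type) [DecidableEq ι] : Type := lp (fun _ : ι => ℂ) 2

/-- The standard orthonormal basis vectors of `L2 ι`. -/
def e {ι : Type} [DecidableEq ι] (i : ι) : L2 ι := lp.single 2 i 1

/-- A family of bounded operators acts irreducibly if every bounded operator commuting with
all members of the family and with all their adjoints is a scalar multiple of the identity. -/
def IsIrreducibleFamily {H : Type} [NormedAddCommGroup H] [InnerProductSpace ℂ H]
    [CompleteSpace H] (Z : Set (H →L[ℂ] H)) : Prop :=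
  ∀ T : H →L[ℂ] H,
    (∀ A ∈ Z, T * A = A * T ∧ T * adjoint A = adjoint A * T) →
    ∃ c : ℂ, T = c • (1 : H →L[ℂ] H)

theorem inner_e {ι : Type} [DecidableEq ι] (i : ι) (v : L2 ι) : inner ℂ (e i) v = v i := by
  simp [e, lp.inner_single_left]

theorem L2_clm_eq_smul_one {ι : Type} [DecidableEq ι] {T : L2 ι →L[ℂ] L2 ι} {c : ℂ}
    (h : ∀ i, T (e i) = c • e i) : T = c • (1 : L2 ι →L[ℂ] L2 ι) := by
  refine lp.ext_continuousLinearMap (by simp) fun i => ?_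
  ext1
  simpa [e] using h i

/-- If `A` sends `e i` to a nonzero multiple of `e j` and `A†` kills `v`, then `v` has no
component along `e j`. -/
theorem apply_eq_zero_of_adjoint_eq_zero {ι : Type} [DecidableEq ι] {A : L2 ι →L[ℂ] L2 ι}
    {i j : ι} {a : ℂ} (ha : a ≠ 0) (hA : A (e i) = a • e j) {v : L2 ι} (hv : adjoint A v = 0) :
    v j = 0 := by
  have h := adjoint_inner_right A (e i) v
  rw [hv, inner_zero_right, hA, inner_smul_left, inner_e] at h
  simpa [ha] using h.symm

/-- The adjoint of `A` kills every basis vector orthogonal to the images of all basis vectors. -/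
theorem adjoint_e_eq_zero {ι : Type} [DecidableEq ι] {A : L2 ι →L[ℂ] L2 ι} {f : ι → ι}
    {a : ι → ℂ} (hA : ∀ i, A (e i) = a i • e (f i)) {j : ι} (hj : ∀ i, f i ≠ j) :
    adjoint A (e j) = 0 := by
  ext i
  rw [← inner_e, adjoint_inner_right, hA, inner_smul_left, inner_e]
  simp [e, hj i]

/-- An eigenvalue equation at `e i` propagates along an operator commuting with `T`. -/
theorem eigen_step {ι : Type} [DecidableEq ι] {A T : L2 ι →L[ℂ] L2 ι} (hTA : T * A = A * T)
    {i j : ι} {a c : ℂ} (ha : a ≠ 0) (hA : A (e i) = a • e j) (hT : T (e i) = c • e i) :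
    T (e j) = c • e j := by
  have h : T (A (e i)) = A (T (e i)) := DFunLike.congr_fun hTA (e i)
  simp only [hA, hT, map_smul] at h
  rw [smul_comm c a] at h
  exact smul_right_injective _ ha h

/-- The representation `π⁽⁴⁾_φ` on `ℓ²(ℤ₊²)`, given by
`Z₁₁ e_{k,l} = q^{2k}e^{iφ} e_{k,l} − q⁻¹√((1−q^{4l})(1−q^{2k+2})(1−q^{2k+4})) e_{k+2,l−1}`
(the second term vanishing when `l = 0`), `Z₂₁ e_{k,l} = q^{2l}√(1−q^{2k+2}) e_{k+1,l}`,
`Z₂₂ e_{k,l} = √(1−q^{4l+4}) e_{k,l+1}`, is irreducible. -/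
theorem stmt7 (q : ℝ) (hq : q ∈ Set.Ioo (0 : ℝ) 1) (φ : ℝ)
    (Z11 Z21 Z22 : L2 (ℕ × ℕ) →L[ℂ] L2 (ℕ × ℕ))
    (h11 : ∀ k l : ℕ, Z11 (e (k, l)) =
      (((q ^ (2 * k) : ℝ) : ℂ) * Complex.exp (φ * Complex.I)) • e (k, l)
      - ((q⁻¹ * Real.sqrt ((1 - q ^ (4 * l)) * (1 - q ^ (2 * k + 2)) * (1 - q ^ (2 * k + 4)))
          : ℝ) : ℂ) • e (k + 2, l - 1))
    (h21 : ∀ k l : ℕ, Z21 (e (k, l)) =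
      ((q ^ (2 * l) * Real.sqrt (1 - q ^ (2 * k + 2)) : ℝ) : ℂ) • e (k + 1, l))
    (h22 : ∀ k l : ℕ, Z22 (e (k, l)) =
      ((Real.sqrt (1 - q ^ (4 * l + 4)) : ℝ) : ℂ) • e (k, l + 1)) :
    IsIrreducibleFamily {Z11, Z21, Z22} := by
  obtain ⟨hq0, hq1⟩ := hq
  have hpos : ∀ n : ℕ, n ≠ 0 → 0 < Real.sqrt (1 - q ^ n) := fun n hn =>
    Real.sqrt_pos.2 (sub_pos.2 (pow_lt_one₀ hq0.le hq1 hn))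
  have h21ne : ∀ k l : ℕ, ((q ^ (2 * l) * Real.sqrt (1 - q ^ (2 * k + 2)) : ℝ) : ℂ) ≠ 0 :=
    fun k l => ofReal_ne_zero.2 (mul_pos (pow_pos hq0 _) (hpos _ (by simp))).ne'
  have h22ne : ∀ l : ℕ, ((Real.sqrt (1 - q ^ (4 * l + 4)) : ℝ) : ℂ) ≠ 0 :=
    fun l => ofReal_ne_zero.2 (hpos _ (by simp)).ne'
  intro T hT
  obtain ⟨hT21, hT21'⟩ := hT Z21 (by simp)
  obtain ⟨hT22, hT22'⟩ := hT Z22 (by simp)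
  have hker21 : adjoint Z21 (T (e (0, 0))) = 0 := by
    have h : T (adjoint Z21 (e (0, 0))) = adjoint Z21 (T (e (0, 0))) :=
      DFunLike.congr_fun hT21' _
    rw [← h, adjoint_e_eq_zero (f := fun i => (i.1 + 1, i.2)) (fun i => h21 i.1 i.2)
      (by simp), map_zero]
  have hker22 : adjoint Z22 (T (e (0, 0))) = 0 := by
    have h : T (adjoint Z22 (e (0, 0))) = adjoint Z22 (T (e (0, 0))) :=
      DFunLike.congr_fun hT22' _
    rw [← h, adjoint_e_eq_zero (f := fun i => (i.1, i.2 + 1)) (fun i => h22 i.1 i.2)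
      (by simp), map_zero]
  refine ⟨T (e (0, 0)) (0, 0), L2_clm_eq_smul_one ?_⟩
  have h00 : T (e (0, 0)) = T (e (0, 0)) (0, 0) • e (0, 0) := by
    ext ⟨k, l⟩
    rcases k with _ | k
    · rcases l with _ | l
      · simp [e]
      · rw [apply_eq_zero_of_adjoint_eq_zero (h22ne l) (h22 0 l) hker22]
        simp [e]
    · rw [apply_eq_zero_of_adjoint_eq_zero (h21ne k l) (h21 k l) hker21]
      simp [e]
  generalize T (e (0, 0)) (0, 0) = c at h00
  have hk0 : ∀ k, T (e (k, 0)) = c • e (k, 0) := fun k => by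
    induction k with
    | zero => exact h00
    | succ k ih => exact eigen_step hT21 (h21ne k 0) (h21 k 0) ih
  rintro ⟨k, l⟩
  induction l with
  | zero => exact hk0 k
  | succ l ih => exact eigen_step hT22 (h22ne l) (h22 k l) ih
end
end

section
/- Let q ∈ (0,1). On ℓ²(ℤ₊³), let Z₁₁, Z₂₁, Z₂₂ be the unique bounded operators with Z₁₁e_{k,l,m} = q^{2l}√(1−q^{4m+4}) e_{k,l,m+1} − q⁻¹√((1−q^{4k})(1−q^{2l+2})(1−q^{2l+4})) e_{k−1,l+2,m} (the second term being 0 when k = 0), Z₂₁e_{k,l,m} = q^{2k}√(1−q^{2l+2}) e_{k,l+1,m}, and Z₂₂e_{k,l,m} = √(1−q^{4k+4}) e_{k+1,l,m}. Then this triple is irreducible: every bounded operator on ℓ²(ℤ₊³) commuting with Z₁₁, Z₂₁, Z₂₂ and their adjoints is a scalar multiple of the identity. -/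
open ContinuousLinearMap Complex

noncomputable section

section BasisVectors

variable {ι : Type} [DecidableEq ι]

theorem inner_e_left (i : ι) (f : L2 ι) : inner ℂ (e i) f = f i := by
  simp [e, lp.inner_single_left]

theorem e_apply (i j : ι) : (e i : L2 ι) j = if j = i then 1 else 0 := by
  rw [e, lp.single_apply]
  split_ifs with h
  · subst h; simp
  · simp [h]

theorem ext_inner_e {f g : L2 ι} (h : ∀ i, inner ℂ (e i) f = inner ℂ (e i) g) : f = g := by
  ext i
  simpa only [inner_e_left] using h i

theorem clm_ext_e {A B : L2 ι →L[ℂ] L2 ι} (h : ∀ i, A (e i) = B (e i)) : A = B := by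
  ext1 f
  have hf : HasSum (fun i => f i • e i) f := by
    have := lp.hasSum_single (p := 2) (by simp) f
    convert this using 2 with i
    rw [e, ← lp.single_smul, smul_eq_mul, mul_one]
  have hA := hf.mapL A
  have hB := hf.mapL B
  simp only [map_smul, h] at hA hB
  exact hA.unique hB

end BasisVectors

section Commutation

variable {H : Type} [NormedAddCommGroup H] [InnerProductSpace ℂ H]

theorem inner_apply_eq_zero_of_adjoint_apply_eq_zero [CompleteSpace H] {T Z : H →L[ℂ] H}
    (hT : T * adjoint Z = adjoint Z * T) {v : H} (hv : adjoint Z v = 0) (x : H) :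
    inner ℂ (Z x) (T v) = 0 := by
  rw [← adjoint_inner_right]
  have h : T (adjoint Z v) = adjoint Z (T v) := congrArg (fun A : H →L[ℂ] H => A v) hT
  rw [← h, hv, map_zero, inner_zero_right]

theorem apply_eq_smul_of_apply_eq_smul {T Z : H →L[ℂ] H} (hT : T * Z = Z * T) {c a : ℂ}
    {v w : H} (ha : a ≠ 0) (hv : T v = c • v) (hw : Z v = a • w) : T w = c • w := by
  have h : T (Z v) = Z (T v) := congrArg (fun A : H →L[ℂ] H => A v) hT
  rw [hw, hv, map_smul, map_smul, hw, smul_comm c a] at h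
  exact smul_right_injective H ha h

end Commutation


/-- The representation `π⁽⁵⁾` on `ℓ²(ℤ₊³)`, given by
`Z₁₁ e_{k,l,m} = q^{2l}√(1−q^{4m+4}) e_{k,l,m+1} − q⁻¹√((1−q^{4k})(1−q^{2l+2})(1−q^{2l+4})) e_{k−1,l+2,m}`
(the second term vanishing when `k = 0`), `Z₂₁ e_{k,l,m} = q^{2k}√(1−q^{2l+2}) e_{k,l+1,m}`,
`Z₂₂ e_{k,l,m} = √(1−q^{4k+4}) e_{k+1,l,m}`, is irreducible. -/
theorem stmt8 (q : ℝ) (hq : q ∈ Set.Ioo (0 : ℝ) 1)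
    (Z11 Z21 Z22 : L2 (ℕ × ℕ × ℕ) →L[ℂ] L2 (ℕ × ℕ × ℕ))
    (h11 : ∀ k l m : ℕ, Z11 (e (k, l, m)) =
      ((q ^ (2 * l) * Real.sqrt (1 - q ^ (4 * m + 4)) : ℝ) : ℂ) • e (k, l, m + 1)
      - ((q⁻¹ * Real.sqrt ((1 - q ^ (4 * k)) * (1 - q ^ (2 * l + 2)) * (1 - q ^ (2 * l + 4)))
          : ℝ) : ℂ) • e (k - 1, l + 2, m))
    (h21 : ∀ k l m : ℕ, Z21 (e (k, l, m)) =
      ((q ^ (2 * k) * Real.sqrt (1 - q ^ (2 * l + 2)) : ℝ) : ℂ) • e (k, l + 1, m))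
    (h22 : ∀ k l m : ℕ, Z22 (e (k, l, m)) =
      ((Real.sqrt (1 - q ^ (4 * k + 4)) : ℝ) : ℂ) • e (k + 1, l, m)) :
    IsIrreducibleFamily {Z11, Z21, Z22} := by
  obtain ⟨hq0, hq1⟩ := hq
  intro T hT
  obtain ⟨hT11, hT11'⟩ := hT Z11 (by simp)
  obtain ⟨hT21, hT21'⟩ := hT Z21 (by simp)
  obtain ⟨hT22, hT22'⟩ := hT Z22 (by simp)
  have hsqrt (n : ℕ) (hn : n ≠ 0) : Real.sqrt (1 - q ^ n) ≠ 0 :=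
    (Real.sqrt_pos.2 (sub_pos.2 (pow_lt_one₀ hq0.le hq1 hn))).ne'
  have h11_zero (l m : ℕ) : Z11 (e (0, l, m)) =
      ((q ^ (2 * l) * Real.sqrt (1 - q ^ (4 * m + 4)) : ℝ) : ℂ) • e (0, l, m + 1) := by
    rw [h11]
    simp
  have ha11 (m : ℕ) : ((q ^ (2 * 0) * Real.sqrt (1 - q ^ (4 * m + 4)) : ℝ) : ℂ) ≠ 0 :=
    ofReal_ne_zero.2 (mul_ne_zero (pow_pos hq0 _).ne' (hsqrt _ (by omega)))
  have ha21 (l : ℕ) : ((q ^ (2 * 0) * Real.sqrt (1 - q ^ (2 * l + 2)) : ℝ) : ℂ) ≠ 0 :=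
    ofReal_ne_zero.2 (mul_ne_zero (pow_pos hq0 _).ne' (hsqrt _ (by omega)))
  have ha22 (k : ℕ) : ((Real.sqrt (1 - q ^ (4 * k + 4)) : ℝ) : ℂ) ≠ 0 :=
    ofReal_ne_zero.2 (hsqrt _ (by omega))
  have hv11 : adjoint Z11 (e (0, 0, 0)) = 0 := by
    refine ext_inner_e fun ⟨k, l, m⟩ => ?_
    rw [adjoint_inner_right, h11, inner_zero_right, inner_sub_left, inner_smul_left,
      inner_smul_left, inner_e_left, inner_e_left, e_apply, e_apply]
    simp
  have hv21 : adjoint Z21 (e (0, 0, 0)) = 0 := by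
    refine ext_inner_e fun ⟨k, l, m⟩ => ?_
    rw [adjoint_inner_right, h21, inner_zero_right, inner_smul_left, inner_e_left, e_apply]
    simp
  have hv22 : adjoint Z22 (e (0, 0, 0)) = 0 := by
    refine ext_inner_e fun ⟨k, l, m⟩ => ?_
    rw [adjoint_inner_right, h22, inner_zero_right, inner_smul_left, inner_e_left, e_apply]
    simp
  set c : ℂ := T (e (0, 0, 0)) (0, 0, 0) with hc
  have hvac : T (e (0, 0, 0)) = c • e (0, 0, 0) := by
    have hcoord {Z : L2 (ℕ × ℕ × ℕ) →L[ℂ] L2 (ℕ × ℕ × ℕ)} (hZ : T * adjoint Z = adjoint Z * T)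
        (hv : adjoint Z (e (0, 0, 0)) = 0) {a : ℂ} (ha : a ≠ 0) {i j : ℕ × ℕ × ℕ}
        (hij : Z (e i) = a • e j) : T (e (0, 0, 0)) j = 0 := by
      have h := inner_apply_eq_zero_of_adjoint_apply_eq_zero hZ hv (e i)
      rw [hij, inner_smul_left, inner_e_left] at h
      exact (mul_eq_zero.1 h).resolve_left ((map_ne_zero _).2 ha)
    ext ⟨k, l, m⟩
    rw [lp.coeFn_smul, Pi.smul_apply, e_apply]
    rcases k with _ | k
    · rcases l with _ | l
      · rcases m with _ | m
        · simp [hc]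
        · simpa using hcoord hT11' hv11 (ha11 m) (h11_zero 0 m)
      · simpa using hcoord hT21' hv21 (ha21 l) (h21 0 l m)
    · simpa using hcoord hT22' hv22 (ha22 k) (h22 k l m)
  have hm (m : ℕ) : T (e (0, 0, m)) = c • e (0, 0, m) := by
    induction m with
    | zero => exact hvac
    | succ m ih => exact apply_eq_smul_of_apply_eq_smul hT11 (ha11 m) ih (h11_zero 0 m)
  have hl (l m : ℕ) : T (e (0, l, m)) = c • e (0, l, m) := by
    induction l with
    | zero => exact hm m
    | succ l ih => exact apply_eq_smul_of_apply_eq_smul hT21 (ha21 l) ih (h21 0 l m)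
  have hk (k l m : ℕ) : T (e (k, l, m)) = c • e (k, l, m) := by
    induction k with
    | zero => exact hl l m
    | succ k ih => exact apply_eq_smul_of_apply_eq_smul hT22 (ha22 k) ih (h22 k l m)
  exact ⟨c, clm_ext_e fun ⟨k, l, m⟩ => hk k l m⟩
end
end
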